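/- arXiv:2602.10292 — 2 statements merged into one kernel-verified Lean document; each statement's English description precedes it below -/
import Mathlib

section
/- (Jiang–Longbrake regularization) Fix integers s, k ≥ 2 with s ≥ 2k. There exists a constant c(k,s) > 0 such that for every n and every family F of k-element subsets of [n] there exists a k-partite subfamily F* ⊆ F (with respect to some partition [n] = X₁ ⊔ … ⊔ X_k) such that: (1) |F*| ≥ c(k,s)·|F|; (2) for each J ∈ Int(F*) and F ∈ F*, |F*(F_J)| ≥ max{ s, |F*| / (2k·n^{|J|}) }; (3) for each J ∈ Int(F*) and F ∈ F*, the family F*(F_J) is s-diverse. -/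
/-- `X : Fin k → Finset ℕ` is a partition of `[n] = {1,…,n}` into `k` parts. -/
def IsPartition (n k : ℕ) (X : Fin k → Finset ℕ) : Prop :=
  (∀ i j, i ≠ j → Disjoint (X i) (X j)) ∧ Finset.univ.biUnion X = Finset.Icc 1 n

/-- The projection `π(Y) = {i ∈ [k] : Y ∩ Xᵢ ≠ ∅}`. -/
def piProj {k : ℕ} (X : Fin k → Finset ℕ) (Y : Finset ℕ) : Finset (Fin k) :=
  Finset.univ.filter (fun i => (Y ∩ X i).Nonempty)

/-- The intersection structure `Int(F) = {π(E ∩ F) : E, F ∈ F, E ≠ F}`. -/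
def IntStr {k : ℕ} (X : Fin k → Finset ℕ) (F : Finset (Finset ℕ)) :
    Finset (Finset (Fin k)) :=
  F.offDiag.image (fun p => piProj X (p.1 ∩ p.2))

/-- `F_J = F ∩ ⋃_{i ∈ J} Xᵢ`. -/
def restrJ {k : ℕ} (X : Fin k → Finset ℕ) (F : Finset ℕ) (J : Finset (Fin k)) :
    Finset ℕ :=
  F ∩ J.biUnion X

/-- `H(Y) = {H \ Y : H ∈ H, Y ⊆ H}`. -/
def fam (H : Finset (Finset ℕ)) (Y : Finset ℕ) : Finset (Finset ℕ) :=
  (H.filter (fun A => Y ⊆ A)).image (fun A => A \ Y)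

/-- A family `H` is `s`-diverse if every element lies in at most `|H|/s` members of `H`. -/
def Diverse (s : ℝ) (H : Finset (Finset ℕ)) : Prop :=
  ∀ v : ℕ, ((H.filter (fun A => v ∈ A)).card : ℝ) ≤ (H.card : ℝ) / s

/-- The largest size of a subfamily of `H` whose intersection structure avoids `J`. -/
def avoidNumber {k : ℕ} (X : Fin k → Finset ℕ) (J : Finset (Fin k)) (H : Finset (Finset ℕ)) : ℕ :=
  (H.powerset.filter (fun G => J ∉ IntStr X G)).sup Finset.card

/-- `A` is a transversal of the parts `X`, contained in `[n]`. -/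
def IsTransversal (n : ℕ) {k : ℕ} (X : Fin k → Finset ℕ) (A : Finset ℕ) : Prop :=
  A ⊆ Finset.Icc 1 n ∧ ∀ i, (A ∩ X i).card = 1

section Basic

variable {n k : ℕ} {X : Fin k → Finset ℕ} {A B Y : Finset ℕ} {J : Finset (Fin k)}
  {G H : Finset (Finset ℕ)}

theorem mem_IntStr : J ∈ IntStr X H ↔ ∃ E ∈ H, ∃ F ∈ H, E ≠ F ∧ piProj X (E ∩ F) = J := by
  simp only [IntStr, Finset.mem_image, Finset.mem_offDiag, Prod.exists]
  constructor
  · rintro ⟨E, F, ⟨hE, hF, hne⟩, h⟩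
    exact ⟨E, hE, F, hF, hne, h⟩
  · rintro ⟨E, hE, F, hF, hne, h⟩
    exact ⟨E, F, ⟨hE, hF, hne⟩, h⟩

theorem mem_piProj {i : Fin k} : i ∈ piProj X A ↔ ∃ a ∈ A, a ∈ X i := by
  simp [piProj, Finset.Nonempty]

theorem mem_restrJ {a : ℕ} : a ∈ restrJ X A J ↔ a ∈ A ∧ ∃ i ∈ J, a ∈ X i := by
  simp [restrJ]

theorem restrJ_subset : restrJ X A J ⊆ A := Finset.inter_subset_left

theorem IntStr_mono (h : G ⊆ H) : IntStr X G ⊆ IntStr X H :=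
  Finset.image_subset_image (Finset.offDiag_mono h)

theorem IsPartition.exists_mem (hX : IsPartition n k X) {a : ℕ} (ha : a ∈ Finset.Icc 1 n) :
    ∃ i, a ∈ X i := by
  rw [← hX.2] at ha
  simpa using ha

theorem IsTransversal.exists_mem (hA : IsTransversal n X A) (i : Fin k) : ∃ a ∈ A, a ∈ X i := by
  obtain ⟨a, ha⟩ := Finset.card_eq_one.1 (hA.2 i)
  have : a ∈ A ∩ X i := by simp [ha]
  exact ⟨a, Finset.mem_inter.1 this⟩

theorem IsTransversal.eq_of_mem (hA : IsTransversal n X A) {i : Fin k} {a b : ℕ}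
    (ha : a ∈ A) (hai : a ∈ X i) (hb : b ∈ A) (hbi : b ∈ X i) : a = b :=
  Finset.card_le_one.1 (hA.2 i).le a (Finset.mem_inter.2 ⟨ha, hai⟩) b
    (Finset.mem_inter.2 ⟨hb, hbi⟩)

theorem fam_card : (fam H Y).card = (H.filter (fun A => Y ⊆ A)).card := by
  refine Finset.card_image_of_injOn fun A hA B hB h => ?_
  simp only [Finset.coe_filter, Set.mem_ofPred_eq] at hA hB
  rw [← Finset.sdiff_union_of_subset hA.2, ← Finset.sdiff_union_of_subset hB.2]
  exact congrArg (· ∪ Y) h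

theorem fam_filter_card_le (v : ℕ) : ((fam H Y).filter (fun A => v ∈ A)).card ≤
    (H.filter (fun A => Y ⊆ A ∧ v ∈ A ∧ v ∉ Y)).card := by
  refine (Finset.card_le_card (t := (H.filter (fun A => Y ⊆ A ∧ v ∈ A ∧ v ∉ Y)).image (· \ Y))
    fun B hB => ?_).trans Finset.card_image_le
  simp only [fam, Finset.mem_filter, Finset.mem_image] at hB ⊢
  obtain ⟨⟨A, ⟨hA, hYA⟩, rfl⟩, hv⟩ := hB
  exact ⟨A, ⟨hA, hYA, Finset.mem_sdiff.1 hv⟩, rfl⟩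

theorem card_le_avoidNumber (h : G ⊆ H) (hJ : J ∉ IntStr X G) : G.card ≤ avoidNumber X J H :=
  Finset.le_sup (f := Finset.card) (Finset.mem_filter.2 ⟨Finset.mem_powerset.2 h, hJ⟩)

theorem exists_card_eq_avoidNumber (X : Fin k → Finset ℕ) (J : Finset (Fin k))
    (H : Finset (Finset ℕ)) : ∃ G ⊆ H, J ∉ IntStr X G ∧ G.card = avoidNumber X J H := by
  have hne : (H.powerset.filter (fun G => J ∉ IntStr X G)).Nonempty :=
    ⟨∅, Finset.mem_filter.2 ⟨by simp, by simp [IntStr]⟩⟩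
  obtain ⟨G, hG, h⟩ := Finset.exists_mem_eq_sup _ hne Finset.card
  simp only [Finset.mem_filter, Finset.mem_powerset] at hG
  exact ⟨G, hG.1, hG.2, h.symm⟩

theorem avoidNumber_mono (h : G ⊆ H) : avoidNumber X J G ≤ avoidNumber X J H := by
  obtain ⟨K, hK, hJ, hc⟩ := exists_card_eq_avoidNumber X J G
  exact hc ▸ card_le_avoidNumber (hK.trans h) hJ

/-- Adding to a `J`-avoiding subfamily all the sets through `A_J` and a further point `v` keeps it
`J`-avoiding, provided no set of the subfamily contains `A_J`. -/
theorem avoidNumber_add_le (hX : IsPartition n k X) (hH : ∀ B ∈ H, IsTransversal n X B)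
    (hA : A ∈ H) (v : ℕ) :
    avoidNumber X J (H.filter (fun B => ¬ restrJ X A J ⊆ B)) +
      (H.filter (fun B => restrJ X A J ⊆ B ∧ v ∈ B ∧ v ∉ restrJ X A J)).card ≤
        avoidNumber X J H := by
  obtain ⟨K, hK, hJ, hc⟩ :=
    exists_card_eq_avoidNumber X J (H.filter (fun B => ¬ restrJ X A J ⊆ B))
  set Z := H.filter (fun B => restrJ X A J ⊆ B ∧ v ∈ B ∧ v ∉ restrJ X A J) with hZ
  have hKmem : ∀ B ∈ K, B ∈ H ∧ ¬ restrJ X A J ⊆ B := fun B hB => by simpa using hK hB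
  have hZmem : ∀ B ∈ Z, B ∈ H ∧ restrJ X A J ⊆ B ∧ v ∈ B ∧ v ∉ restrJ X A J :=
    fun B hB => by simpa [hZ] using hB
  have hdisj : Disjoint K Z := Finset.disjoint_left.2 fun B hB hB' =>
    (hKmem B hB).2 (hZmem B hB').2.1
  rw [← hc, ← Finset.card_union_of_disjoint hdisj]
  have cross : ∀ E ∈ K, ∀ F ∈ Z, piProj X (E ∩ F) ≠ J := by
    intro E hE F hF h
    refine (hKmem E hE).2 fun y hy => ?_
    obtain ⟨-, i, hi, hyi⟩ := mem_restrJ.1 hy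
    rw [← h] at hi
    obtain ⟨z, hz, hzi⟩ := mem_piProj.1 hi
    rw [Finset.mem_inter] at hz
    have hyF := (hZmem F hF).2.1 hy
    rw [(hH F (hZmem F hF).1).eq_of_mem hyF hyi hz.2 hzi]
    exact hz.1
  refine card_le_avoidNumber (Finset.union_subset (fun B hB => (hKmem B hB).1)
    (fun B hB => (hZmem B hB).1)) fun hmem => ?_
  obtain ⟨E, hE, F, hF, hne, h⟩ := mem_IntStr.1 hmem
  rcases Finset.mem_union.1 hE with hE | hE <;> rcases Finset.mem_union.1 hF with hF | hF
  · exact hJ (mem_IntStr.2 ⟨E, hE, F, hF, hne, h⟩)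
  · exact cross E hE F hF h
  · exact cross F hF E hE (by rwa [Finset.inter_comm])
  · obtain ⟨hEH, hYE, hvE, hvY⟩ := hZmem E hE
    obtain ⟨i, hvi⟩ := hX.exists_mem ((hH E hEH).1 hvE)
    have hi : i ∈ J := h ▸ mem_piProj.2 ⟨v, Finset.mem_inter.2 ⟨hvE, (hZmem F hF).2.2.1⟩, hvi⟩
    obtain ⟨a, haA, hai⟩ := (hH A hA).exists_mem i
    have haY : a ∈ restrJ X A J := mem_restrJ.2 ⟨haA, i, hi, hai⟩
    exact hvY ((hH E hEH).eq_of_mem hvE hvi (hYE haY) hai ▸ haY)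

theorem univ_notMem_IntStr (hX : IsPartition n k X) (hH : ∀ B ∈ H, IsTransversal n X B) :
    Finset.univ ∉ IntStr X H := by
  intro hmem
  obtain ⟨E, hE, F, hF, hne, h⟩ := mem_IntStr.1 hmem
  have hz : ∀ i, ∃ z, z ∈ E ∧ z ∈ F ∧ z ∈ X i := fun i => by
    obtain ⟨z, hz, hzi⟩ := mem_piProj.1 (h ▸ Finset.mem_univ i)
    exact ⟨z, (Finset.mem_inter.1 hz).1, (Finset.mem_inter.1 hz).2, hzi⟩
  refine hne (Finset.Subset.antisymm (fun e he => ?_) fun e he => ?_)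
  · obtain ⟨i, hi⟩ := hX.exists_mem ((hH E hE).1 he)
    obtain ⟨z, hzE, hzF, hzi⟩ := hz i
    exact (hH E hE).eq_of_mem he hi hzE hzi ▸ hzF
  · obtain ⟨i, hi⟩ := hX.exists_mem ((hH F hF).1 he)
    obtain ⟨z, hzE, hzF, hzi⟩ := hz i
    exact (hH F hF).eq_of_mem he hi hzF hzi ▸ hzE

theorem Diverse.le_card_fam {s : ℝ} (hs : 0 < s) (hX : IsPartition n k X)
    (hH : ∀ B ∈ H, IsTransversal n X B) (hJ : J ∈ IntStr X H) (hA : A ∈ H)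
    (h : Diverse s (fam H (restrJ X A J))) : s ≤ ((fam H (restrJ X A J)).card : ℝ) := by
  have hJu : J ≠ Finset.univ := by
    rintro rfl
    exact univ_notMem_IntStr hX hH hJ
  obtain ⟨i, hi⟩ : ∃ i, i ∉ J := by
    by_contra! hcon
    exact hJu (Finset.eq_univ_of_forall hcon)
  obtain ⟨a, haA, hai⟩ := (hH A hA).exists_mem i
  have haY : a ∉ restrJ X A J := by
    rw [mem_restrJ]
    rintro ⟨-, j, hj, haj⟩
    have hij : i ≠ j := by
      rintro rfl
      exact hi hj
    exact Finset.disjoint_left.1 (hX.1 i j hij) hai haj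
  have hpos : 0 < ((fam H (restrJ X A J)).filter (fun B => a ∈ B)).card := by
    refine Finset.card_pos.2 ⟨A \ restrJ X A J, ?_⟩
    simp only [fam, Finset.mem_filter, Finset.mem_image, Finset.mem_sdiff]
    exact ⟨⟨A, ⟨hA, restrJ_subset⟩, rfl⟩, haA, haY⟩
  have h1 : (1 : ℝ) ≤ ((fam H (restrJ X A J)).filter (fun B => a ∈ B)).card := by
    exact_mod_cast hpos
  have := h1.trans (h a)
  rwa [le_div_iff₀ hs, one_mul] at this

/-- The number of traces `A_J` is at most the product of the part sizes over `J`. -/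
theorem card_image_restrJ_le (hH : ∀ B ∈ H, IsTransversal n X B) (J : Finset (Fin k)) :
    (H.image (fun A => restrJ X A J)).card ≤ ∏ i ∈ J, (X i).card := by
  have hsub : H.image (fun A => restrJ X A J) ⊆
      (J.pi (fun i => (X i).powersetCard 1)).image
        (fun f => J.attach.biUnion fun i => f i.1 i.2) := by
    intro Y hY
    obtain ⟨A, hA, rfl⟩ := Finset.mem_image.1 hY
    refine Finset.mem_image.2 ⟨fun i _ => A ∩ X i, ?_, ?_⟩
    · simp only [Finset.mem_pi, Finset.mem_powersetCard]
      exact fun i _ => ⟨Finset.inter_subset_right, (hH A hA).2 i⟩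
    · ext a
      simp only [mem_restrJ, Finset.mem_biUnion, Finset.mem_attach, true_and, Finset.mem_inter,
        Subtype.exists]
      constructor
      · rintro ⟨i, hi, ha, hai⟩
        exact ⟨ha, i, hi, hai⟩
      · rintro ⟨ha, i, hi, hai⟩
        exact ⟨i, hi, ha, hai⟩
  calc _ ≤ _ := Finset.card_le_card hsub
    _ ≤ _ := Finset.card_image_le
    _ = ∏ i ∈ J, (X i).card := by simp [Finset.card_pi]

theorem sum_threshold_le (hX : IsPartition n k X) (hk : 2 ≤ k)
    (hH : ∀ B ∈ H, IsTransversal n X B) (𝒥 : Finset (Finset (Fin k))) :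
    ∑ J ∈ 𝒥, (H.card : ℝ) / (2 * (k : ℝ) * (n : ℝ) ^ J.card) *
      ((H.image (fun A => restrJ X A J)).card : ℝ) ≤ 7 / 10 * H.card := by
  have hk' : (2 : ℝ) ≤ k := by exact_mod_cast hk
  have hsum : ∑ i, ((X i).card : ℝ) / n ≤ 1 := by
    rw [← Finset.sum_div]
    have : ∑ i, (X i).card = n := by
      rw [← Finset.card_biUnion fun i _ j _ hij => hX.1 i j hij, hX.2]
      simp
    have h' : ∑ i, ((X i).card : ℝ) = n := by exact_mod_cast this
    rw [h']
    exact div_self_le_one _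
  have hprod : ∏ i, (1 + ((X i).card : ℝ) / n) ≤ 2.8 := by
    calc _ ≤ ∏ i, Real.exp (((X i).card : ℝ) / n) :=
          Finset.prod_le_prod (fun i _ => by positivity)
            fun i _ => by linarith [Real.add_one_le_exp (((X i).card : ℝ) / n)]
      _ = Real.exp (∑ i, ((X i).card : ℝ) / n) := (Real.exp_sum _ _).symm
      _ ≤ Real.exp 1 := Real.exp_le_exp.2 hsum
      _ ≤ 2.8 := by linarith [Real.exp_one_lt_d9]
  calc _ ≤ ∑ J ∈ 𝒥, (H.card : ℝ) / (2 * k) * ∏ i ∈ J, (((X i).card : ℝ) / n) := by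
        refine Finset.sum_le_sum fun J _ => ?_
        have hc : ((H.image (fun A => restrJ X A J)).card : ℝ) ≤ ∏ i ∈ J, ((X i).card : ℝ) := by
          exact_mod_cast card_image_restrJ_le hH J
        rw [Finset.prod_div_distrib, Finset.prod_const]
        calc _ ≤ (H.card : ℝ) / (2 * (k : ℝ) * (n : ℝ) ^ J.card) * ∏ i ∈ J, ((X i).card : ℝ) := by
              gcongr
          _ = _ := by ring
    _ ≤ ∑ J ∈ Finset.univ.powerset,
          (H.card : ℝ) / (2 * k) * ∏ i ∈ J, (((X i).card : ℝ) / n) := by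
        refine Finset.sum_le_sum_of_subset_of_nonneg (fun J _ => by simp) fun J _ _ => ?_
        positivity
    _ = (H.card : ℝ) / (2 * k) * ∏ i, (1 + ((X i).card : ℝ) / n) := by
        rw [Finset.prod_one_add, Finset.mul_sum]
    _ ≤ (H.card : ℝ) / (2 * 2) * 2.8 := by gcongr
    _ = 7 / 10 * H.card := by ring

/-- Maximizing a potential over the subfamilies of `H` yields a subfamily all of whose links of
types in `𝒥` are large and diverse. -/
theorem exists_subfamily_large_diverse {s : ℝ} (hs : 0 < s) (hX : IsPartition n k X)
    (hH : ∀ B ∈ H, IsTransversal n X B) (𝒥 : Finset (Finset (Fin k)))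
    (τ : Finset (Fin k) → ℝ) (hτ : ∀ J, 0 ≤ τ J) :
    ∃ R ⊆ H, (∀ J ∈ 𝒥, ∀ A ∈ R, τ J ≤ ((fam R (restrJ X A J)).card : ℝ) ∧
        Diverse s (fam R (restrJ X A J))) ∧
      (H.card : ℝ) - ∑ J ∈ 𝒥, τ J * ((H.image (fun A => restrJ X A J)).card : ℝ)
        - ∑ J ∈ 𝒥, s * (avoidNumber X J H : ℝ) ≤ R.card := by
  let S : Finset (Finset ℕ) → ℝ := fun R =>
    ∑ J ∈ 𝒥, τ J * ((R.image (fun A => restrJ X A J)).card : ℝ)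
  let T : Finset (Finset ℕ) → ℝ := fun R => ∑ J ∈ 𝒥, s * (avoidNumber X J R : ℝ)
  obtain ⟨R, hR, hmax⟩ := Finset.exists_max_image H.powerset (fun R => (R.card : ℝ) - S R - T R)
    ⟨H, by simp⟩
  rw [Finset.mem_powerset] at hR
  refine ⟨R, hR, fun J hJ A hA => ?_, ?_⟩
  · set Y := restrJ X A J with hY
    set R' := R.filter (fun B => ¬ Y ⊆ B) with hR'
    have hR'R : R' ⊆ R := Finset.filter_subset _ _
    have hcard : ((fam R Y).card : ℝ) + R'.card = R.card := by
      rw [fam_card]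
      exact_mod_cast Finset.card_filter_add_card_filter_not (s := R) (fun B => Y ⊆ B)
    have hle := hmax R' (Finset.mem_powerset.2 (hR'R.trans hR))
    have hSt : ∀ K, τ K * ((R'.image (fun A => restrJ X A K)).card : ℝ) ≤
        τ K * ((R.image (fun A => restrJ X A K)).card : ℝ) := fun K => by
      refine mul_le_mul_of_nonneg_left ?_ (hτ K)
      exact_mod_cast Finset.card_le_card (Finset.image_subset_image hR'R)
    have hTt : ∀ K, s * (avoidNumber X K R' : ℝ) ≤ s * (avoidNumber X K R : ℝ) := fun K => by
      refine mul_le_mul_of_nonneg_left ?_ hs.le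
      exact_mod_cast avoidNumber_mono hR'R
    have hS : S R' + τ J ≤ S R := by
      have himg : (R'.image (fun A => restrJ X A J)).card + 1 ≤
          (R.image (fun A => restrJ X A J)).card := by
        refine Finset.card_lt_card (Finset.ssubset_iff_subset_ne.2
          ⟨Finset.image_subset_image hR'R, fun heq => ?_⟩)
        have hmem : Y ∈ R'.image (fun A => restrJ X A J) :=
          heq ▸ Finset.mem_image.2 ⟨A, hA, rfl⟩
        obtain ⟨B, hB, hBY⟩ := Finset.mem_image.1 hmem
        exact (Finset.mem_filter.1 hB).2 (hBY ▸ restrJ_subset)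
      have himg' : ((R'.image (fun A => restrJ X A J)).card : ℝ) + 1 ≤
          (R.image (fun A => restrJ X A J)).card := by exact_mod_cast himg
      have h1 := mul_le_mul_of_nonneg_left himg' (hτ J)
      have h2 : ∑ K ∈ 𝒥.erase J, τ K * ((R'.image (fun A => restrJ X A K)).card : ℝ) ≤
          ∑ K ∈ 𝒥.erase J, τ K * ((R.image (fun A => restrJ X A K)).card : ℝ) :=
        Finset.sum_le_sum fun K _ => hSt K
      simp only [S]
      rw [← Finset.add_sum_erase _ _ hJ, ← Finset.add_sum_erase 𝒥
        (fun K => τ K * ((R.image (fun A => restrJ X A K)).card : ℝ)) hJ]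
      linarith
    have hT : ∀ v : ℕ, T R' + s * (((fam R Y).filter (fun B => v ∈ B)).card : ℝ) ≤ T R := by
      intro v
      have h0 : avoidNumber X J R' + ((fam R Y).filter (fun B => v ∈ B)).card ≤
          avoidNumber X J R :=
        (Nat.add_le_add_left (fam_filter_card_le v) _).trans
          (avoidNumber_add_le hX (fun B hB => hH B (hR hB)) hA v)
      have h0' : (avoidNumber X J R' : ℝ) + ((fam R Y).filter (fun B => v ∈ B)).card ≤
          avoidNumber X J R := by exact_mod_cast h0
      have h1 := mul_le_mul_of_nonneg_left h0' hs.le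
      have h2 : ∑ K ∈ 𝒥.erase J, s * (avoidNumber X K R' : ℝ) ≤
          ∑ K ∈ 𝒥.erase J, s * (avoidNumber X K R : ℝ) :=
        Finset.sum_le_sum fun K _ => hTt K
      simp only [T]
      rw [← Finset.add_sum_erase _ _ hJ, ← Finset.add_sum_erase 𝒥
        (fun K => s * (avoidNumber X K R : ℝ)) hJ]
      linarith
    refine ⟨?_, fun v => ?_⟩
    · have hT' : T R' ≤ T R := Finset.sum_le_sum fun K _ => hTt K
      linarith
    · rw [le_div_iff₀ hs]
      linarith [hT v, hτ J]
  · have hle := hmax H (Finset.mem_powerset.2 (Finset.Subset.refl H))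
    have hS : 0 ≤ S R := Finset.sum_nonneg fun J _ => mul_nonneg (hτ J) (Nat.cast_nonneg _)
    have hT : 0 ≤ T R := Finset.sum_nonneg fun J _ => mul_nonneg hs.le (Nat.cast_nonneg _)
    simp only [S, T] at hle hS hT
    linarith

theorem exists_regular_subfamily {s : ℝ} (hs : 2 ≤ s) (hk : 2 ≤ k) (hX : IsPartition n k X)
    (m : ℕ) : ∀ H : Finset (Finset ℕ), (∀ B ∈ H, IsTransversal n X B) →
      (IntStr X H).card ≤ m → ∃ R ⊆ H,
        (1 / (5 * s * 2 ^ k)) ^ (m + 1) * (H.card : ℝ) ≤ R.card ∧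
        ∀ J ∈ IntStr X R, ∀ A ∈ R,
          (R.card : ℝ) / (2 * (k : ℝ) * (n : ℝ) ^ J.card) ≤ ((fam R (restrJ X A J)).card : ℝ) ∧
          Diverse s (fam R (restrJ X A J)) := by
  set δ : ℝ := 1 / (5 * s * 2 ^ k) with hδ
  have hs0 : 0 < s := by linarith
  have hδ0 : 0 < δ := by positivity
  have hδs : s * δ * 2 ^ k = 1 / 5 := by
    rw [hδ]
    field_simp
  have hδ1 : δ ≤ 1 / 10 := by
    have h2k : (1 : ℝ) ≤ 2 ^ k := one_le_pow₀ (by norm_num)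
    rw [hδ]
    apply one_div_le_one_div_of_le (by norm_num)
    nlinarith
  induction m using Nat.strong_induction_on with
  | _ m ih =>
    intro H hH hm
    by_cases hall : ∀ J ∈ IntStr X H, (avoidNumber X J H : ℝ) ≤ δ * H.card
    · obtain ⟨R, hRH, hgood, hcard⟩ := exists_subfamily_large_diverse hs0 hX hH (IntStr X H)
        (fun J => (H.card : ℝ) / (2 * (k : ℝ) * (n : ℝ) ^ J.card)) (fun J => by positivity)
      refine ⟨R, hRH, ?_, fun J hJ A hA => ?_⟩
      · have h1 := sum_threshold_le hX hk hH (IntStr X H)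
        have h2 : ∑ J ∈ IntStr X H, s * (avoidNumber X J H : ℝ) ≤ 1 / 5 * H.card := by
          calc _ ≤ ∑ J ∈ IntStr X H, s * (δ * H.card) :=
                Finset.sum_le_sum fun J hJ => mul_le_mul_of_nonneg_left (hall J hJ) hs0.le
            _ ≤ ∑ J : Finset (Fin k), s * (δ * H.card) :=
                Finset.sum_le_sum_of_subset_of_nonneg (Finset.subset_univ _)
                  fun J _ _ => by positivity
            _ = s * δ * 2 ^ k * H.card := by
                simp
                ring
            _ = 1 / 5 * H.card := by rw [hδs]
        have h3 : ∀ j : ℕ, δ ^ (j + 1) * (H.card : ℝ) ≤ 1 / 10 * H.card := fun j => by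
          gcongr
          calc δ ^ (j + 1) ≤ δ ^ 1 := pow_le_pow_of_le_one hδ0.le (by linarith) (by omega)
            _ ≤ 1 / 10 := by simpa using hδ1
        refine (h3 _).trans ?_
        linarith
      · obtain ⟨h1, h2⟩ := hgood J (IntStr_mono hRH hJ) A hA
        refine ⟨le_trans ?_ h1, h2⟩
        have : (R.card : ℝ) ≤ H.card := by exact_mod_cast Finset.card_le_card hRH
        gcongr
    · push Not at hall
      obtain ⟨J, hJ, hlt⟩ := hall
      have hpos : 0 < (IntStr X H).card := Finset.card_pos.2 ⟨J, hJ⟩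
      obtain _ | m := m
      · omega
      obtain ⟨G, hGH, hJG, hGc⟩ := exists_card_eq_avoidNumber X J H
      have hss : (IntStr X G).card < (IntStr X H).card :=
        Finset.card_lt_card (Finset.ssubset_iff_subset_ne.2
          ⟨IntStr_mono hGH, fun heq => hJG (heq ▸ hJ)⟩)
      obtain ⟨R, hRG, hcard, hgood⟩ :=
        ih m (Nat.lt_succ_self m) G (fun B hB => hH B (hGH hB)) (by omega)
      refine ⟨R, hRG.trans hGH, le_trans ?_ hcard, hgood⟩
      rw [pow_succ, mul_assoc]
      rw [← hGc] at hlt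
      gcongr

end Basic

/-- Every `k`-uniform family has a `k`-partite subfamily containing a `k ^ (-k)` fraction of it. -/
theorem exists_partite_subfamily {n k : ℕ} (hk : 0 < k) (F : Finset (Finset ℕ))
    (hF : ∀ A ∈ F, A ⊆ Finset.Icc 1 n ∧ A.card = k) :
    ∃ G ⊆ F, ∃ X : Fin k → Finset ℕ, IsPartition n k X ∧ (∀ A ∈ G, IsTransversal n X A) ∧
      1 / (k : ℝ) ^ k * (F.card : ℝ) ≤ G.card := by
  classical
  have : NeZero k := ⟨hk.ne'⟩
  let ext : (Finset.Icc 1 n → Fin k) → ℕ → Fin k :=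
    fun f a => if h : a ∈ Finset.Icc 1 n then f ⟨a, h⟩ else 0
  let part : (Finset.Icc 1 n → Fin k) → Fin k → Finset ℕ :=
    fun f i => (Finset.Icc 1 n).filter (fun a => ext f a = i)
  have hpart : ∀ f, IsPartition n k (part f) := by
    intro f
    refine ⟨fun i j hij => Finset.disjoint_left.2 fun a hi hj => hij ?_, ?_⟩
    · exact (Finset.mem_filter.1 hi).2.symm.trans (Finset.mem_filter.1 hj).2
    · ext a
      simp [part]
  have hcount : ∀ A ∈ F, k ^ n ≤ k ^ k *
      (Finset.univ.filter (fun f : Finset.Icc 1 n → Fin k => IsTransversal n (part f) A)).card := by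
    intro A hA
    obtain ⟨hAn, hAk⟩ := hF A hA
    let e : A ≃ Fin k := Finset.equivFinOfCardEq hAk
    let D : Finset (Finset.Icc 1 n → Fin k) := Fintype.piFinset fun a =>
      if h : a.1 ∈ A then {e ⟨a.1, h⟩} else Finset.univ
    have hD : D ⊆
        Finset.univ.filter (fun f : Finset.Icc 1 n → Fin k => IsTransversal n (part f) A) := by
      intro f hf
      have hfe : ∀ a (h : a ∈ A), ext f a = e ⟨a, h⟩ := fun a h => by
        have := Fintype.mem_piFinset.1 hf ⟨a, hAn h⟩
        simp only [h, dite_true, Finset.mem_singleton] at this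
        simp only [ext, hAn h, dite_true, this]
      refine Finset.mem_filter.2 ⟨Finset.mem_univ _, hAn, fun i => ?_⟩
      refine Finset.card_eq_one.2 ⟨(e.symm i).1, ?_⟩
      ext a
      simp only [part, Finset.mem_inter, Finset.mem_filter, Finset.mem_singleton]
      constructor
      · rintro ⟨ha, -, hai⟩
        rw [hfe a ha] at hai
        rw [← hai]
        simp
      · rintro rfl
        have h := (e.symm i).2
        refine ⟨h, hAn h, ?_⟩
        rw [hfe _ h]
        simp
    have hDc : D.card * k ^ k = k ^ n := by
      have h1 : D.card = ∏ a : Finset.Icc 1 n, (if a.1 ∈ A then 1 else k) := by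
        rw [Fintype.card_piFinset]
        refine Finset.prod_congr rfl fun a _ => ?_
        split_ifs <;> simp
      have h2 : ∏ a : Finset.Icc 1 n, (if a.1 ∈ A then 1 else k) =
          ∏ a ∈ Finset.Icc 1 n, (if a ∈ A then 1 else k) :=
        Finset.prod_coe_sort (Finset.Icc 1 n) (fun a => if a ∈ A then 1 else k)
      have h3 : ∏ a ∈ Finset.Icc 1 n, (if a ∈ A then k else 1) = k ^ k := by
        rw [Finset.prod_ite_mem, Finset.inter_eq_right.2 hAn, Finset.prod_const, hAk]
      rw [h1, h2, ← h3, ← Finset.prod_mul_distrib]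
      calc _ = ∏ a ∈ Finset.Icc 1 n, k := by
            refine Finset.prod_congr rfl fun a _ => ?_
            split_ifs <;> simp
        _ = k ^ n := by simp
    rw [← hDc, mul_comm]
    exact Nat.mul_le_mul_left _ (Finset.card_le_card hD)
  let sub : (Finset.Icc 1 n → Fin k) → Finset (Finset ℕ) :=
    fun f => F.filter (fun A => IsTransversal n (part f) A)
  have hdc : ∑ f : Finset.Icc 1 n → Fin k, (sub f).card =
      ∑ A ∈ F, (Finset.univ.filter
        (fun f : Finset.Icc 1 n → Fin k => IsTransversal n (part f) A)).card := by
    simp only [sub, Finset.card_filter]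
    exact Finset.sum_comm
  have hcardI : (Finset.univ : Finset (Finset.Icc 1 n → Fin k)).card = k ^ n := by
    simp
  obtain ⟨f, -, hf⟩ : ∃ f ∈ (Finset.univ : Finset (Finset.Icc 1 n → Fin k)),
      F.card ≤ k ^ k * (sub f).card := by
    refine Finset.exists_le_of_sum_le ⟨fun _ => 0, Finset.mem_univ _⟩ ?_
    rw [← Finset.mul_sum, hdc, Finset.sum_const, hcardI, Finset.mul_sum, smul_eq_mul, mul_comm,
      ← smul_eq_mul]
    exact Finset.card_nsmul_le_sum _ _ _ hcount
  refine ⟨sub f, Finset.filter_subset _ _, part f, hpart f,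
    fun A hA => (Finset.mem_filter.1 hA).2, ?_⟩
  have hf' : (F.card : ℝ) ≤ (k : ℝ) ^ k * (sub f).card := by exact_mod_cast hf
  rw [one_div_mul_eq_div, div_le_iff₀ (by positivity), mul_comm]
  exact hf'

/-- Jiang–Longbrake regularization theorem. -/
theorem jiang_longbrake (s k : ℕ) (hs : 2 ≤ s) (hk : 2 ≤ k) (hsk : 2 * k ≤ s) :
    ∃ c : ℝ, 0 < c ∧ ∀ n : ℕ, ∀ F : Finset (Finset ℕ),
      (∀ A ∈ F, A ⊆ Finset.Icc 1 n ∧ A.card = k) →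
      ∃ Fs ⊆ F, ∃ X : Fin k → Finset ℕ, IsPartition n k X ∧
        (∀ A ∈ Fs, ∀ i, (A ∩ X i).card = 1) ∧
        c * (F.card : ℝ) ≤ (Fs.card : ℝ) ∧
        (∀ J ∈ IntStr X Fs, ∀ A ∈ Fs,
          max (s : ℝ) ((Fs.card : ℝ) / (2 * (k : ℝ) * (n : ℝ) ^ J.card))
            ≤ ((fam Fs (restrJ X A J)).card : ℝ)) ∧
        (∀ J ∈ IntStr X Fs, ∀ A ∈ Fs, Diverse (s : ℝ) (fam Fs (restrJ X A J))) := by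
  have hs0 : (0 : ℝ) < s := by positivity
  refine ⟨(1 / (5 * (s : ℝ) * 2 ^ k)) ^ (2 ^ k + 1) * (1 / (k : ℝ) ^ k), by positivity,
    fun n F hF => ?_⟩
  obtain ⟨G, hGF, X, hX, hG, hGc⟩ := exists_partite_subfamily (by omega) F hF
  have hm : (IntStr X G).card ≤ 2 ^ k := by
    simpa using Finset.card_le_univ (IntStr X G)
  obtain ⟨R, hRG, hRc, hgood⟩ :=
    exists_regular_subfamily (s := (s : ℝ)) (by exact_mod_cast hs) hk hX (2 ^ k) G hG hm
  have hR : ∀ A ∈ R, IsTransversal n X A := fun A hA => hG A (hRG hA)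
  refine ⟨R, hRG.trans hGF, X, hX, fun A hA => (hR A hA).2, ?_, fun J hJ A hA => ?_,
    fun J hJ A hA => (hgood J hJ A hA).2⟩
  · refine le_trans ?_ hRc
    rw [mul_assoc]
    gcongr
  · exact max_le ((hgood J hJ A hA).2.le_card_fam hs0 hX hR hJ hA) (hgood J hJ A hA).1
end

section
/- Fix positive integers k and t with k ≥ 2t+1. There exists a constant c > 0, depending only on k, such that for every n and every t-avoiding family F of k-element subsets of [n], one has |∂^{(k-t-1)}(F)| ≥ c·|F|. -/
/-- The `i`-shadow `∂⁽ⁱ⁾(F) = {D : |D| = i, D ⊆ F for some F ∈ F}`. -/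
def shadow (i : ℕ) (F : Finset (Finset ℕ)) : Finset (Finset ℕ) :=
  F.biUnion (fun A => A.powersetCard i)

open Finset in
/-- If every vertex of `S` has a neighbour in `T`, and along every edge the endpoint in `T` has
degree at most that of the endpoint in `S`, then `S` is no larger than `T`. -/
theorem card_le_card_of_degree_le {α β : Type*} (r : α → β → Prop) [∀ x y, Decidable (r x y)]
    (S : Finset α) (T : Finset β)
    (hpos : ∀ x ∈ S, 0 < #{p ∈ T | r x p})
    (hdeg : ∀ x ∈ S, ∀ p ∈ T, r x p → #{y ∈ S | r y p} ≤ #{q ∈ T | r x q}) :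
    #S ≤ #T := by
  have h1 : (#S : ℚ) = ∑ x ∈ S, ∑ p ∈ T with r x p, (1 : ℚ) / #{q ∈ T | r x q} := by
    rw [card_eq_sum_ones, Nat.cast_sum]
    refine sum_congr rfl fun x hx => ?_
    have := hpos x hx
    rw [sum_const, nsmul_eq_mul, Nat.cast_one, mul_one_div_cancel]
    exact_mod_cast this.ne'
  have h2 : ∑ x ∈ S, ∑ p ∈ T with r x p, (1 : ℚ) / #{q ∈ T | r x q} ≤
      ∑ x ∈ S, ∑ p ∈ T with r x p, (1 : ℚ) / #{y ∈ S | r y p} := by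
    refine sum_le_sum fun x hx => sum_le_sum fun p hp => ?_
    rw [mem_filter] at hp
    have hpos' : 0 < #{y ∈ S | r y p} := card_pos.2 ⟨x, mem_filter.2 ⟨hx, hp.2⟩⟩
    exact one_div_le_one_div_of_le (by exact_mod_cast hpos')
      (by exact_mod_cast hdeg x hx p hp.1 hp.2)
  have h3 : ∑ x ∈ S, ∑ p ∈ T with r x p, (1 : ℚ) / #{y ∈ S | r y p} =
      ∑ p ∈ T, ∑ x ∈ S with r x p, (1 : ℚ) / #{y ∈ S | r y p} := by
    simp only [sum_filter]
    exact sum_comm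
  have h4 : ∑ p ∈ T, ∑ x ∈ S with r x p, (1 : ℚ) / #{y ∈ S | r y p} ≤ ∑ p ∈ T, 1 := by
    refine sum_le_sum fun p _ => ?_
    rw [sum_const, nsmul_eq_mul]
    rw [mul_one_div]
    exact div_self_le_one _
  have h5 : (#S : ℚ) ≤ #T := by
    rw [h1]
    exact h2.trans (h3.trans_le (h4.trans (by simp)))
  exact_mod_cast h5

open Finset in
/-- If no `J ⊆ N` has exactly `#J - e - 1` common neighbours in `V`, then every biclique `R × P`
with `#R = #P + e` satisfies `#N(P) ≤ #N(R) + e`. -/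
theorem card_commonNeighbors_le {α β : Type*} [DecidableEq α] [DecidableEq β]
    (r : α → β → Prop) [∀ x y, Decidable (r x y)] (N : Finset α) (V : Finset β) (e : ℕ)
    (h : ∀ J ⊆ N, #{p ∈ V | ∀ x ∈ J, r x p} + e + 1 ≠ #J) (d : ℕ) :
    ∀ R ⊆ N, ∀ P ⊆ V, (∀ x ∈ R, ∀ p ∈ P, r x p) → #R = #P + e → #N ≤ #R + d →
      #{x ∈ N | ∀ p ∈ P, r x p} ≤ #{p ∈ V | ∀ x ∈ R, r x p} + e := by
  induction d with
  | zero =>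
    intro R _ P hP hRP hcard hN
    have h1 : #P ≤ #{p ∈ V | ∀ x ∈ R, r x p} :=
      card_le_card fun p hp => mem_filter.2 ⟨hP hp, fun x hx => hRP x hx p hp⟩
    have h2 := card_filter_le N (fun x => ∀ p ∈ P, r x p)
    omega
  | succ d ih =>
    intro R hR P hP hRP hcard hN
    set X := {x ∈ N | ∀ p ∈ P, r x p} with hX
    set Y := {p ∈ V | ∀ x ∈ R, r x p} with hY
    have hRX : R ⊆ X := fun x hx => mem_filter.2 ⟨hR hx, fun p hp => hRP x hx p hp⟩
    have hPY : P ⊆ Y := fun p hp => mem_filter.2 ⟨hP hp, fun x hx => hRP x hx p hp⟩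
    have hdegX : ∀ x ∈ X \ R,
        #{p ∈ V | ∀ y ∈ insert x R, r y p} = #{p ∈ Y \ P | r x p} + #P := by
      intro x hx
      rw [← card_union_of_disjoint]
      · congr 1
        ext p
        simp only [hX, hY, mem_filter, mem_sdiff, mem_union, mem_insert, forall_eq_or_imp] at hx ⊢
        constructor
        · rintro ⟨hp, hxp, hRp⟩
          by_cases hpP : p ∈ P
          · exact Or.inr hpP
          · exact Or.inl ⟨⟨⟨hp, hRp⟩, hpP⟩, hxp⟩
        · rintro (hp | hp)
          · exact ⟨hp.1.1.1, hp.2, hp.1.1.2⟩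
          · exact ⟨hP hp, hx.1.2 p hp, fun y hy => hRP y hy p hp⟩
      · exact disjoint_left.2 fun p hp => (mem_sdiff.1 (mem_filter.1 hp).1).2
    have hdegY : ∀ p ∈ Y \ P,
        #{x ∈ N | ∀ q ∈ insert p P, r x q} = #{x ∈ X \ R | r x p} + #R := by
      intro p hp
      rw [← card_union_of_disjoint]
      · congr 1
        ext x
        simp only [hX, hY, mem_filter, mem_sdiff, mem_union, mem_insert, forall_eq_or_imp] at hp ⊢
        constructor
        · rintro ⟨hx, hxp, hxP⟩
          by_cases hxR : x ∈ R
          · exact Or.inr hxR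
          · exact Or.inl ⟨⟨⟨hx, hxP⟩, hxR⟩, hxp⟩
        · rintro (hx | hx)
          · exact ⟨hx.1.1.1, hx.2, hx.1.1.2⟩
          · exact ⟨hR hx, hp.1.2 x hx, fun q hq => hRP x hx q hq⟩
      · exact disjoint_left.2 fun x hx => (mem_sdiff.1 (mem_filter.1 hx).1).2
    have key : #(X \ R) ≤ #(Y \ P) := by
      refine card_le_card_of_degree_le r _ _ (fun x hx => ?_) (fun x hx p hp hxp => ?_)
      · have h1 := hdegX x hx
        have h2 := mem_sdiff.1 hx
        have h3 := h (insert x R) (insert_subset (mem_filter.1 h2.1).1 hR)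
        rw [card_insert_of_notMem h2.2] at h3
        omega
      · have hx' := mem_sdiff.1 hx
        have hp' := mem_sdiff.1 hp
        have hxm := mem_filter.1 hx'.1
        have hpm := mem_filter.1 hp'.1
        have h1 := ih (insert x R) (insert_subset hxm.1 hR) (insert p P) (insert_subset hpm.1 hP)
          (by
            intro y hy q hq
            rcases mem_insert.1 hy with rfl | hy <;> rcases mem_insert.1 hq with rfl | hq
            · exact hxp
            · exact hxm.2 q hq
            · exact hpm.2 y hy
            · exact hRP y hy q hq)
          (by rw [card_insert_of_notMem hx'.2, card_insert_of_notMem hp'.2]; omega)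
          (by rw [card_insert_of_notMem hx'.2]; omega)
        rw [hdegX x hx, hdegY p hp] at h1
        omega
    have h1 := card_sdiff_add_card_eq_card hRX
    have h2 := card_sdiff_add_card_eq_card hPY
    omega

open Finset in
/-- A form of the Frankl–Katona theorem: among more than `#V + e` subsets of `V` there are some
`s` whose intersection has size exactly `s - e - 1`. -/
theorem exists_card_commonNeighbors_eq {α β : Type*} [DecidableEq α] [DecidableEq β]
    (r : α → β → Prop) [∀ x y, Decidable (r x y)] (N : Finset α) (V : Finset β) (e : ℕ)
    (hN : #V + e < #N) : ∃ J ⊆ N, #{p ∈ V | ∀ x ∈ J, r x p} + e + 1 = #J := by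
  by_contra! h
  obtain ⟨R, hR, hRc⟩ := exists_subset_card_eq (show e ≤ #N by omega)
  have hle := card_commonNeighbors_le r N V e h #N R hR ∅ (empty_subset _)
    (fun _ _ p hp => absurd hp (notMem_empty p)) (by rw [card_empty, zero_add, hRc])
    (Nat.le_add_left _ _)
  rw [filter_true_of_mem fun _ _ p hp => absurd hp (notMem_empty p)] at hle
  have h1 := card_filter_le V (fun p => ∀ x ∈ R, r x p)
  omega

open Finset in
/-- An intersection-closed family on `k ≥ 2t+1` points without members of size `t` leaves some
`(k-t-1)`-set uncovered by its proper members. -/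
theorem exists_uncovered_of_inter_closed {ι : Type*} [Fintype ι] [DecidableEq ι]
    (I : Set (Finset ι)) (huniv : univ ∈ I) (hinter : ∀ A ∈ I, ∀ B ∈ I, A ∩ B ∈ I)
    (t : ℕ) (ht : 2 * t + 1 ≤ Fintype.card ι) (hI : ∀ A ∈ I, #A ≠ t) :
    ∃ B : Finset ι, #B = Fintype.card ι - t - 1 ∧ ∀ A ∈ I, B ⊆ A → A = univ := by
  by_contra! hcov
  let free : Finset ι → Prop := fun Z => ∀ A ∈ I, Aᶜ ⊆ Z → A = univ
  have : DecidablePred free := Classical.decPred free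
  have free_card : ∀ Z, free Z → #Z ≤ t := by
    intro Z hZ
    by_contra! hlt
    obtain ⟨W, hWZ, hW⟩ := exists_subset_card_eq (show t + 1 ≤ #Z from hlt)
    obtain ⟨A, hA, hWA, hne⟩ := hcov Wᶜ (by rw [card_compl]; omega)
    exact hne (hZ A hA ((compl_le_iff_compl_le.1 hWA : Aᶜ ⊆ W).trans hWZ))
  obtain ⟨Z, hZ, hmax⟩ := exists_max_image ({Z | free Z} : Finset (Finset ι)) card
    ⟨∅, by
      rw [mem_filter]
      exact ⟨mem_univ _, fun A _ hA => by simpa using hA⟩⟩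
  replace hZ : free Z := (mem_filter.1 hZ).2
  have hZt := free_card Z hZ
  have hex : ∀ x, ∃ A ∈ I, x ∉ Z → Aᶜ ⊆ insert x Z ∧ x ∉ A := by
    intro x
    by_cases hx : x ∈ Z
    · exact ⟨univ, huniv, fun h => absurd hx h⟩
    have hnot : ¬ free (insert x Z) := by
      intro hf
      have := hmax _ (mem_filter.2 ⟨mem_univ _, hf⟩)
      rw [card_insert_of_notMem hx] at this
      omega
    simp only [free] at hnot
    push Not at hnot
    obtain ⟨A, hA, hAZ, hne⟩ := hnot
    refine ⟨A, hA, fun _ => ⟨hAZ, fun hxA => hne (hZ A hA fun y hy => ?_)⟩⟩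
    rcases mem_insert.1 (hAZ hy) with rfl | h
    · exact absurd hxA (mem_compl.1 hy)
    · exact h
  choose M hMI hM using hex
  have hinf : ∀ J : Finset ι, J.inf M ∈ I := by
    intro J
    induction J using Finset.induction_on with
    | empty => simpa using huniv
    | insert x J _ ih => rw [inf_insert]; exact hinter _ (hMI x) _ ih
  have hcZ : #Zᶜ = Fintype.card ι - #Z := card_compl Z
  have hviol : ∀ J ⊆ Zᶜ,
      #{p ∈ Z | ∀ x ∈ J, p ∈ M x} + (Fintype.card ι - #Z - t - 1) + 1 ≠ #J := by
    intro J hJ heq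
    have hJle := card_le_card hJ
    have hset : J.inf M = (Zᶜ \ J) ∪ {p ∈ Z | ∀ x ∈ J, p ∈ M x} := by
      ext p
      simp only [mem_inf, mem_union, mem_sdiff, mem_compl, mem_filter]
      constructor
      · intro hp
        by_cases hpZ : p ∈ Z
        · exact Or.inr ⟨hpZ, hp⟩
        · exact Or.inl ⟨hpZ, fun hpJ => (hM p hpZ).2 (hp p hpJ)⟩
      · rintro (⟨hpZ, hpJ⟩ | hp) x hx
        · by_contra hpM
          rcases mem_insert.1 ((hM x (mem_compl.1 (hJ hx))).1 (mem_compl.2 hpM)) with rfl | h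
          · exact hpJ hx
          · exact hpZ h
        · exact hp.2 x hx
    have hcard := card_union_of_disjoint (s := Zᶜ \ J) (t := {p ∈ Z | ∀ x ∈ J, p ∈ M x})
      (disjoint_left.2 fun p hp hp' =>
        mem_compl.1 (mem_sdiff.1 hp).1 (mem_filter.1 hp').1)
    rw [← hset] at hcard
    have h1 := card_sdiff_add_card_eq_card hJ
    exact hI _ (hinf J) (by omega)
  obtain ⟨J, hJ, heq⟩ := exists_card_commonNeighbors_eq (fun x p => p ∈ M x) Zᶜ Z
    (Fintype.card ι - #Z - t - 1) (by omega)
  refine hviol J hJ ?_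
  convert heq

/-- The restriction of `f` to `A` is rich in `G`: members of `G` extending it can avoid any given
function outside `A`. -/
def IsRich {ι V : Type*} (G : Finset (ι → V)) (f : ι → V) (A : Finset ι) : Prop :=
  ∀ h : ι → V, ∃ g ∈ G, (∀ i ∈ A, g i = f i) ∧ ∀ i ∉ A, g i ≠ h i

namespace IsRich

variable {ι V : Type*} {G H : Finset (ι → V)} {f g : ι → V} {A B : Finset ι}

theorem mono (hGH : G ⊆ H) (h : IsRich G f A) : IsRich H f A := fun u =>
  let ⟨v, hv, hv'⟩ := h u
  ⟨v, hGH hv, hv'⟩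

theorem of_agree (hGH : ∀ v ∈ G, (∀ i ∈ A, v i = f i) → v ∈ H) (hfg : ∀ i ∈ A, f i = g i)
    (h : IsRich G f A) : IsRich H g A := fun u =>
  let ⟨v, hv, hv1, hv2⟩ := h u
  ⟨v, hGH v hv hv1, fun i hi => (hv1 i hi).trans (hfg i hi), hv2⟩

theorem inter [DecidableEq ι] (hA : IsRich G f A) (hB : ∀ g ∈ G, IsRich G g B) :
    IsRich G f (A ∩ B) := by
  intro h
  obtain ⟨u, hu, hu1, hu2⟩ := hA h
  obtain ⟨v, hv, hv1, hv2⟩ := hB u hu h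
  refine ⟨v, hv, fun i hi => ?_, fun i hi => ?_⟩
  · rw [Finset.mem_inter] at hi
    rw [hv1 i hi.2, hu1 i hi.1]
  · by_cases hiB : i ∈ B
    · rw [hv1 i hiB]
      exact hu2 i fun hiA => hi (Finset.mem_inter.2 ⟨hiA, hiB⟩)
    · exact hv2 i hiB

end IsRich

open Finset in
/-- Any family splits into a part where all patterns of `I` are rich and, for each pattern of `I`,
a part where that pattern is never rich. -/
theorem exists_rich_decomposition {ι V : Type*} [DecidableEq ι] [DecidableEq (ι → V)]
    (I : Finset (Finset ι)) (G : Finset (ι → V)) :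
    ∃ (H : Finset (ι → V)) (D : Finset ι → Finset (ι → V)),
      H ⊆ G ∧ (∀ A, D A ⊆ G) ∧ G ⊆ H ∪ I.biUnion D ∧
      (∀ A ∈ I, ∀ f ∈ H, IsRich H f A) ∧ (∀ A ∈ I, ∀ f ∈ D A, ¬ IsRich (D A) f A) := by
  classical
  induction G using Finset.strongInduction with
  | H G ih =>
    by_cases hG : ∀ A ∈ I, ∀ f ∈ G, IsRich G f A
    · exact ⟨G, fun _ => ∅, Subset.rfl, fun _ => empty_subset _, subset_union_left, hG, by simp⟩
    push Not at hG
    obtain ⟨A, hA, f, hf, hpoor⟩ := hG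
    set E := {g ∈ G | ∀ i ∈ A, g i = f i}
    have hfE : f ∈ E := mem_filter.2 ⟨hf, fun _ _ => rfl⟩
    obtain ⟨H, D, hH, hD, hcov, hrich, hD'⟩ := ih (G \ E)
      ⟨sdiff_subset, fun h => (mem_sdiff.1 (h hf)).2 hfE⟩
    refine ⟨H, Function.update D A (D A ∪ E), hH.trans sdiff_subset, fun B => ?_, fun g hg => ?_,
      hrich, fun B hB g hg => ?_⟩
    · by_cases hBA : B = A
      · subst hBA
        rw [Function.update_self]
        exact union_subset ((hD B).trans sdiff_subset) (filter_subset _ _)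
      · rw [Function.update_of_ne hBA]
        exact (hD B).trans sdiff_subset
    · by_cases hgE : g ∈ E
      · refine mem_union_right _ (mem_biUnion.2 ⟨A, hA, ?_⟩)
        rw [Function.update_self]
        exact mem_union_right _ hgE
      · rcases mem_union.1 (hcov (mem_sdiff.2 ⟨hg, hgE⟩)) with h | h
        · exact mem_union_left _ h
        · obtain ⟨B, hB, hgB⟩ := mem_biUnion.1 h
          refine mem_union_right _ (mem_biUnion.2 ⟨B, hB, ?_⟩)
          by_cases hBA : B = A
          · subst hBA
            rw [Function.update_self]
            exact mem_union_left _ hgB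
          · rwa [Function.update_of_ne hBA]
    · by_cases hBA : B = A
      · subst hBA
        rw [Function.update_self] at hg ⊢
        have hsub : D B ∪ E ⊆ G := union_subset ((hD B).trans sdiff_subset) (filter_subset _ _)
        intro hr
        by_cases hgE : g ∈ E
        · exact hpoor (hr.of_agree (fun v hv _ => hsub hv) (mem_filter.1 hgE).2)
        · have hgD : g ∈ D B := (mem_union.1 hg).resolve_right hgE
          refine hD' B hB g hgD (hr.of_agree (fun v hv hvg => ?_) fun _ _ => rfl)
          refine (mem_union.1 hv).resolve_right fun hvE => hgE ?_
          refine mem_filter.2 ⟨hsub hg, fun i hi => ?_⟩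
          rw [← hvg i hi, (mem_filter.1 hvE).2 i hi]
      · rw [Function.update_of_ne hBA] at hg ⊢
        exact hD' B hB g hg

open Finset in
/-- A positive proportion of any family is homogeneous: each pattern is rich at all members or at
none of them. -/
theorem exists_homogeneous_subfamily {ι V : Type*} [Fintype ι] [DecidableEq ι]
    [DecidableEq (ι → V)] (I : Finset (Finset ι)) :
    ∀ G : Finset (ι → V), (∀ A ∉ I, ∀ f ∈ G, ¬ IsRich G f A) →
      ∃ (J : Finset (Finset ι)) (H : Finset (ι → V)), H ⊆ G ∧
        #G ≤ (Fintype.card (Finset ι) + 1) ^ (#I + 1) * #H ∧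
        ∀ A, ∀ f ∈ H, (A ∈ J ↔ IsRich H f A) := by
  induction I using Finset.strongInduction with
  | H I ih =>
    intro G hG
    obtain ⟨H, D, hH, hD, hcov, hrich, hpoor⟩ := exists_rich_decomposition I G
    set M := Fintype.card (Finset ι)
    have hIM : #I ≤ M := card_le_univ I
    by_cases hcard : #G ≤ (M + 1) * #H
    · refine ⟨I, H, hH, hcard.trans ?_, fun A f hf => ⟨fun hA => hrich A hA f hf, fun hr => ?_⟩⟩
      · exact Nat.mul_le_mul_right _ (Nat.le_self_pow (by omega) _)
      · by_contra hA
        exact hG A hA f (hH hf) (hr.mono hH)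
    · obtain ⟨A, hA, hDA⟩ : ∃ A ∈ I, #G ≤ (M + 1) * #(D A) := by
        by_contra! hlt
        have h1 : #G ≤ #H + ∑ A ∈ I, #(D A) :=
          (card_le_card hcov).trans ((card_union_le _ _).trans
            (Nat.add_le_add_left card_biUnion_le _))
        have h2 : (M + 1) * ∑ A ∈ I, #(D A) ≤ #I * #G := by
          rw [mul_sum, ← smul_eq_mul (a := #I)]
          exact sum_le_card_nsmul _ _ _ fun A hA => (hlt A hA).le
        have h3 : #I * #G ≤ M * #G := Nat.mul_le_mul_right _ hIM
        push Not at hcard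
        nlinarith
      obtain ⟨J, K, hK, hKc, hJ⟩ := ih (I.erase A) (erase_ssubset hA) (D A) (by
        intro B hB f hf hr
        by_cases hBA : B = A
        · subst hBA
          exact hpoor B hA f hf hr
        · exact hG B (fun hBI => hB (mem_erase.2 ⟨hBA, hBI⟩)) f (hD A hf) (hr.mono (hD A)))
      refine ⟨J, K, hK.trans (hD A), hDA.trans ?_, hJ⟩
      rw [card_erase_of_mem hA, Nat.sub_add_cancel (card_pos.2 ⟨A, hA⟩)] at hKc
      calc (M + 1) * #(D A) ≤ (M + 1) * ((M + 1) ^ #I * #K) := Nat.mul_le_mul_left _ hKc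
        _ = (M + 1) ^ (#I + 1) * #K := by ring

open Finset in
/-- If no proper pattern containing `B` is rich, then few members extend a given function on a
pattern containing `B`. -/
theorem card_agree_le_of_not_isRich {ι V : Type*} [Fintype ι] [DecidableEq ι] [DecidableEq V]
    (G : Finset (ι → V)) (B : Finset ι)
    (hB : ∀ A, B ⊆ A → A ≠ univ → ∀ f ∈ G, ¬ IsRich G f A) (d : ℕ) :
    ∀ A, B ⊆ A → #Aᶜ = d → ∀ f : ι → V,
      #{g ∈ G | ∀ i ∈ A, g i = f i} ≤ Fintype.card ι ^ d := by
  induction d with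
  | zero =>
    intro A _ hA f
    rw [card_eq_zero, compl_eq_empty_iff] at hA
    subst hA
    rw [pow_zero, card_le_one]
    intro g hg h hh
    ext i
    rw [(mem_filter.1 hg).2 i (mem_univ i), (mem_filter.1 hh).2 i (mem_univ i)]
  | succ d ih =>
    intro A hBA hA f
    rcases Finset.eq_empty_or_nonempty {g ∈ G | ∀ i ∈ A, g i = f i} with h0 | ⟨u, hu⟩
    · simp [h0]
    rw [mem_filter] at hu
    have hne : A ≠ univ := by
      rintro rfl
      simp at hA
    have hpoor := hB A hBA hne u hu.1
    simp only [IsRich] at hpoor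
    push Not at hpoor
    obtain ⟨h, hh⟩ := hpoor
    have hsub : {g ∈ G | ∀ i ∈ A, g i = f i} ⊆ Aᶜ.biUnion fun j =>
        {g ∈ G | ∀ i ∈ insert j A, g i = Function.update f j (h j) i} := by
      intro g hg
      rw [mem_filter] at hg
      obtain ⟨j, hj, hgj⟩ := hh g hg.1 fun i hi => (hg.2 i hi).trans (hu.2 i hi).symm
      refine mem_biUnion.2 ⟨j, mem_compl.2 hj, mem_filter.2 ⟨hg.1, fun i hi => ?_⟩⟩
      by_cases hij : i = j
      · subst hij
        rw [Function.update_self, hgj]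
      · rw [Function.update_of_ne hij]
        exact hg.2 i ((mem_insert.1 hi).resolve_left hij)
    calc #{g ∈ G | ∀ i ∈ A, g i = f i}
        ≤ ∑ j ∈ Aᶜ, #{g ∈ G | ∀ i ∈ insert j A, g i = Function.update f j (h j) i} :=
          (card_le_card hsub).trans card_biUnion_le
      _ ≤ #Aᶜ • Fintype.card ι ^ d := by
          refine sum_le_card_nsmul _ _ _ fun j hj => ih _ (hBA.trans (subset_insert _ _)) ?_ _
          rw [compl_insert, card_erase_of_mem hj, hA, Nat.add_sub_cancel]
      _ ≤ Fintype.card ι ^ (d + 1) := by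
          rw [smul_eq_mul, pow_succ, mul_comm]
          exact Nat.mul_le_mul_left _ (card_le_univ _)

open Finset in
/-- A family of functions on `k ≥ 2t+1` coordinates in which no two members agree on exactly `t`
coordinates has a proportional subfamily whose restriction to some `k-t-1` coordinates has bounded
fibres. -/
theorem exists_restriction_card_fiber_le {ι V : Type*} [Fintype ι] [DecidableEq ι]
    [DecidableEq V] (t : ℕ) (ht : 2 * t + 1 ≤ Fintype.card ι) (G : Finset (ι → V))
    (hG : ∀ f ∈ G, ∀ g ∈ G, f ≠ g → #{i | f i = g i} ≠ t) :
    ∃ H ⊆ G, ∃ B : Finset ι, #B = Fintype.card ι - t - 1 ∧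
      #G ≤ (2 ^ Fintype.card ι + 1) ^ (2 ^ Fintype.card ι + 1) * #H ∧
      ∀ f : ι → V, ∀ S ⊆ H, (∀ g ∈ S, ∀ i ∈ B, g i = f i) → #S ≤ Fintype.card ι ^ (t + 1) := by
  obtain ⟨J, H, hH, hcard, hJ⟩ := exists_homogeneous_subfamily (univ : Finset (Finset ι)) G
    (fun A hA => absurd (mem_univ A) hA)
  rw [card_univ, Fintype.card_finset] at hcard
  rcases H.eq_empty_or_nonempty with rfl | ⟨f, hf⟩
  · obtain ⟨B, -, hB⟩ := exists_subset_card_eq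
      (show Fintype.card ι - t - 1 ≤ #(univ : Finset ι) by rw [card_univ]; omega)
    exact ⟨∅, hH, B, hB, hcard, fun f S hS _ => by simp [subset_empty.1 hS]⟩
  obtain ⟨B, hBc, hB⟩ := exists_uncovered_of_inter_closed (J : Set (Finset ι))
    ((hJ univ f hf).2 fun h => ⟨f, hf, by simp, by simp⟩)
    (fun A hA C hC => (hJ _ f hf).2
      (((hJ A f hf).1 hA).inter fun g hg => (hJ C g hg).1 hC)) t ht (by
      intro A hA hAt
      obtain ⟨g, hg, hg1, hg2⟩ := (hJ A f hf).1 hA f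
      have hset : ({i | f i = g i} : Finset ι) = A := by
        ext i
        rw [mem_filter]
        constructor
        · rintro ⟨-, hi⟩
          by_contra hiA
          exact hg2 i hiA hi.symm
        · exact fun hi => ⟨mem_univ i, (hg1 i hi).symm⟩
      refine hG f (hH hf) g (hH hg) ?_ (by rw [hset, hAt])
      rintro rfl
      have : A = univ := by rw [← hset]; simp
      rw [this, card_univ] at hAt
      omega)
  refine ⟨H, hH, B, hBc, hcard, fun f S hS hSf =>
    (card_le_card fun g hg => mem_filter.2 ⟨hS hg, hSf g hg⟩).trans
      (card_agree_le_of_not_isRich H B ?_ (t + 1) B Subset.rfl ?_ f)⟩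
  · intro A hBA hne g hg hr
    exact hne (hB A ((hJ A g hg).2 hr) hBA)
  · rw [card_compl]
    omega

open Finset in
/-- Some colouring with `k` colours is injective on at least a `k⁻ᵏ` proportion of a family of
`k`-sets. -/
theorem exists_coloring_injOn {k : ℕ} (hk : 0 < k) (n : ℕ) (F : Finset (Finset ℕ))
    (hF : ∀ A ∈ F, A ⊆ Icc 1 n ∧ #A = k) :
    ∃ c : ℕ → Fin k, ∃ F' ⊆ F, (∀ A ∈ F', Set.InjOn c A) ∧ #F ≤ k ^ k * #F' := by
  classical
  have : NeZero k := ⟨hk.ne'⟩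
  let col : (Fin (n + 1) → Fin k) → ℕ → Fin k := fun ω x => ω (Fin.ofNat (n + 1) x)
  have hgood : ∀ A ∈ F, Fintype.card (Fin (n + 1) → Fin k) ≤
      k ^ k * #{ω : Fin (n + 1) → Fin k | Set.InjOn (col ω) A} := by
    intro A hA
    obtain ⟨hAn, hAk⟩ := hF A hA
    let e : A ≃ Fin k := A.equivFinOfCardEq hAk
    let recol : (Fin (n + 1) → Fin k) → Fin (n + 1) → Fin k :=
      fun ω y => if h : (y : ℕ) ∈ A then e ⟨y, h⟩ else ω y
    have hval : ∀ x ∈ A, ((Fin.ofNat (n + 1) x : Fin (n + 1)) : ℕ) = x := by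
      intro x hx
      have := (mem_Icc.1 (hAn hx)).2
      simp only [Fin.val_ofNat]
      exact Nat.mod_eq_of_lt (by omega)
    have hover : ∀ ω, ∀ x (hx : x ∈ A), col (recol ω) x = e ⟨x, hx⟩ := by
      intro ω x hx
      simp only [col, recol, hval x hx, hx, dite_true]
    rw [← card_univ, mul_comm]
    have hcardA : k ^ k = #(univ : Finset (A → Fin k)) := by
      simp [hAk]
    rw [hcardA, ← card_product]
    refine card_le_card_of_injOn
      (fun ω => (recol ω, fun a : A => ω (Fin.ofNat (n + 1) a))) (fun ω _ => ?_) ?_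
    · refine mem_coe.2 (mem_product.2 ⟨mem_filter.2 ⟨mem_univ _, fun x hx y hy hxy => ?_⟩,
        mem_univ _⟩)
      rw [hover ω x hx, hover ω y hy] at hxy
      simpa using e.injective hxy
    · intro ω _ ω' _ heq
      obtain ⟨h1, h2⟩ := Prod.mk.inj heq
      ext y : 1
      by_cases hy : (y : ℕ) ∈ A
      · have := congrFun h2 ⟨y, hy⟩
        simpa using this
      · have := congrFun h1 y
        simpa [recol, hy] using this
  have hsum : ∑ _ω : Fin (n + 1) → Fin k, #F ≤
      ∑ ω : Fin (n + 1) → Fin k, k ^ k * #(F.filter fun A : Finset ℕ => Set.InjOn (col ω) A) := by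
    rw [sum_const, card_univ, smul_eq_mul, ← mul_sum, mul_comm, ← smul_eq_mul (a := #F)]
    have hcomm := sum_card_bipartiteAbove_eq_sum_card_bipartiteBelow
      (s := (univ : Finset (Fin (n + 1) → Fin k))) (t := F)
      (fun ω (A : Finset ℕ) => Set.InjOn (col ω) A)
    simp only [bipartiteAbove, bipartiteBelow] at hcomm
    rw [hcomm, mul_sum]
    exact card_nsmul_le_sum _ _ _ hgood
  obtain ⟨ω, -, hω⟩ := exists_le_of_sum_le (univ_nonempty) hsum
  exact ⟨col ω, _, filter_subset _ _, fun A hA => (mem_filter.1 hA).2, hω⟩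

open Finset in
/-- The shadow bound with an explicit constant. -/
theorem card_le_mul_card_shadow {k t n : ℕ} (hk : 0 < k) (ht : 2 * t + 1 ≤ k)
    (F : Finset (Finset ℕ)) (hF : ∀ A ∈ F, A ⊆ Icc 1 n ∧ #A = k)
    (hav : ∀ A ∈ F, ∀ B ∈ F, A ≠ B → #(A ∩ B) ≠ t) :
    #F ≤ k ^ k * ((2 ^ k + 1) ^ (2 ^ k + 1) * (k ^ k * #(_root_.shadow (k - t - 1) F))) := by
  classical
  obtain ⟨c, F', hF', hinj, hcard⟩ := exists_coloring_injOn hk n F hF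
  have hex : ∀ A : Finset ℕ, ∃ f : Fin k → ℕ,
      A ∈ F' → (∀ i, c (f i) = i) ∧ univ.image f = A := by
    intro A
    by_cases hA : A ∈ F'
    · have himg : A.image c = univ := by
        rw [← card_eq_iff_eq_univ, card_image_of_injOn (hinj A hA), (hF A (hF' hA)).2,
          Fintype.card_fin]
      have hpre : ∀ i, ∃ x ∈ A, c x = i := fun i => mem_image.1 (himg ▸ mem_univ i)
      choose f hfA hfc using hpre
      refine ⟨f, fun _ => ⟨hfc, eq_of_subset_of_card_le ?_ ?_⟩⟩
      · intro x hx
        obtain ⟨i, -, rfl⟩ := mem_image.1 hx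
        exact hfA i
      · rw [card_image_of_injective _ (Function.LeftInverse.injective hfc), card_univ,
          Fintype.card_fin, (hF A (hF' hA)).2]
    · exact ⟨fun _ => 0, fun h => absurd h hA⟩
  choose φ hφ using hex
  have hφinj : Set.InjOn φ F' := fun A hA B hB h => by
    rw [← (hφ A hA).2, ← (hφ B hB).2, h]
  have hcol : ∀ f ∈ F'.image φ, ∀ i, c (f i) = i := by
    intro f hf
    obtain ⟨A, hA, rfl⟩ := mem_image.1 hf
    exact (hφ A hA).1
  obtain ⟨H, hH, B, hB, hGH, hfib⟩ := exists_restriction_card_fiber_le t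
    (by rwa [Fintype.card_fin]) (F'.image φ) (by
      intro f hf g hg hne
      obtain ⟨A, hA, rfl⟩ := mem_image.1 hf
      obtain ⟨C, hC, rfl⟩ := mem_image.1 hg
      have hAC : A ≠ C := fun h => hne (by rw [h])
      have hset : A ∩ C = ({i | φ A i = φ C i} : Finset (Fin k)).image (φ A) := by
        ext x
        rw [mem_inter, mem_image]
        constructor
        · rintro ⟨hxA, hxC⟩
          rw [← (hφ A hA).2] at hxA
          rw [← (hφ C hC).2] at hxC
          obtain ⟨i, -, rfl⟩ := mem_image.1 hxA
          obtain ⟨j, -, hj⟩ := mem_image.1 hxC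
          have hij : j = i := by rw [← (hφ C hC).1 j, hj, (hφ A hA).1 i]
          subst hij
          exact ⟨j, mem_filter.2 ⟨mem_univ _, hj.symm⟩, rfl⟩
        · rintro ⟨i, hi, rfl⟩
          refine ⟨?_, ?_⟩
          · exact (hφ A hA).2.subset (mem_image_of_mem _ (mem_univ i))
          · rw [(mem_filter.1 hi).2]
            exact (hφ C hC).2.subset (mem_image_of_mem _ (mem_univ i))
      rw [← card_image_of_injective _ (Function.LeftInverse.injective (hφ A hA).1), ← hset]
      exact hav A (hF' hA) C (hF' hC) hAC)
  rw [Fintype.card_fin] at hB hGH hfib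
  rw [card_image_of_injOn hφinj] at hGH
  have hHS : #H ≤ k ^ (t + 1) * #(H.image fun f => B.image f) := by
    refine card_le_mul_card_image _ _ fun D hD => ?_
    obtain ⟨f, hf, rfl⟩ := mem_image.1 hD
    refine hfib f _ (filter_subset _ _) fun g hg i hi => ?_
    rw [mem_filter] at hg
    obtain ⟨j, -, hj⟩ := mem_image.1 (hg.2 ▸ mem_image_of_mem g hi : g i ∈ B.image f)
    have hij : j = i := by rw [← hcol f (hH hf) j, hj, hcol g (hH hg.1) i]
    rw [← hj, hij]
  have hshadow : (H.image fun f => B.image f) ⊆ _root_.shadow (k - t - 1) F := by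
    intro D hD
    obtain ⟨f, hf, rfl⟩ := mem_image.1 hD
    obtain ⟨A, hA, rfl⟩ := mem_image.1 (hH hf)
    refine mem_biUnion.2 ⟨A, hF' hA, mem_powersetCard.2 ⟨?_, ?_⟩⟩
    · exact (image_subset_image (subset_univ B)).trans (hφ A hA).2.subset
    · rw [card_image_of_injective _ (Function.LeftInverse.injective (hφ A hA).1), hB]
  refine hcard.trans (Nat.mul_le_mul_left _ (hGH.trans (Nat.mul_le_mul_left _ (hHS.trans ?_))))
  exact Nat.mul_le_mul (Nat.pow_le_pow_right hk (by omega)) (card_le_card hshadow)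

/-- Frankl–Füredi Theorem 5.1: a `t`-avoiding family of `k`-sets with `k ≥ 2t+1`
has `(k-t-1)`-shadow of size at least `c|F|`, where `c` depends only on `k`. -/
theorem shadow_of_t_avoiding (k : ℕ) (hk : 0 < k) :
    ∃ c : ℝ, 0 < c ∧ ∀ t : ℕ, 0 < t → 2 * t + 1 ≤ k →
      ∀ n : ℕ, ∀ F : Finset (Finset ℕ),
        (∀ A ∈ F, A ⊆ Finset.Icc 1 n ∧ A.card = k) →
        (∀ A ∈ F, ∀ B ∈ F, A ≠ B → (A ∩ B).card ≠ t) →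
        c * (F.card : ℝ) ≤ ((shadow (k - t - 1) F).card : ℝ) := by
  set C : ℕ := k ^ k * ((2 ^ k + 1) ^ (2 ^ k + 1) * k ^ k) with hC
  have hCpos : 0 < (C : ℝ) := by
    have : 0 < C := by positivity
    exact_mod_cast this
  refine ⟨(C : ℝ)⁻¹, inv_pos.2 hCpos, fun t _ htk n F hF hav => ?_⟩
  rw [inv_mul_le_iff₀ hCpos]
  have h := card_le_mul_card_shadow hk htk F hF hav
  rw [← mul_assoc _ (k ^ k), ← mul_assoc (k ^ k), ← hC] at h
  exact_mod_cast h
end
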